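/- arXiv:2102.04908 — 4 statements merged into one kernel-verified Lean document; each statement's English description precedes it below -/
import Mathlib

section
/- Let A₁, A₂, A₃, λ ∈ ℝ and define f : ℝ² → ℝ² by f(r₁, r₂) = (A₁r₁(A₃r₂² + (λ²/2)A₂), A₂r₂(A₃r₁² + (λ²/2)A₁)), and I : ℝ² → ℝ by I(r₁, r₂) = A₁r₂² - A₂r₁². If R : ℝ → ℝ² is differentiable and satisfies R'(t) = f(R(t)) for all t, then (d/dt) I(R(t)) = λ²A₁A₂ · I(R(t)) for all t. -/
/-- Along solutions of the reduced triad system `R' = f(R)`, the triad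
invariant `I(r₁, r₂) = A₁r₂² - A₂r₁²` satisfies `(d/dt) I(R(t)) = λ²A₁A₂ I(R(t))`. -/
theorem triad_invariant_evolution (A₁ A₂ A₃ lam : ℝ)
    (f : ℝ × ℝ → ℝ × ℝ)
    (hf : ∀ r₁ r₂ : ℝ, f (r₁, r₂) =
      (A₁ * r₁ * (A₃ * r₂ ^ 2 + lam ^ 2 / 2 * A₂),
       A₂ * r₂ * (A₃ * r₁ ^ 2 + lam ^ 2 / 2 * A₁)))
    (I : ℝ × ℝ → ℝ)
    (hI : ∀ r₁ r₂ : ℝ, I (r₁, r₂) = A₁ * r₂ ^ 2 - A₂ * r₁ ^ 2)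
    (R : ℝ → ℝ × ℝ) (hR : ∀ t : ℝ, HasDerivAt R (f (R t)) t) :
    ∀ t : ℝ, HasDerivAt (fun t => I (R t)) (lam ^ 2 * A₁ * A₂ * I (R t)) t := by
  intro t
  have hI' : ∀ p : ℝ × ℝ, I p = A₁ * p.2 ^ 2 - A₂ * p.1 ^ 2 := fun p => hI p.1 p.2
  have hf' : f (R t) = (A₁ * (R t).1 * (A₃ * (R t).2 ^ 2 + lam ^ 2 / 2 * A₂),
       A₂ * (R t).2 * (A₃ * (R t).1 ^ 2 + lam ^ 2 / 2 * A₁)) := hf (R t).1 (R t).2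
  have h := hR t
  rw [hf'] at h
  have h1 := (hasFDerivAt_fst (𝕜 := ℝ) (p := R t)).comp_hasDerivAt t h
  have h2 := (hasFDerivAt_snd (𝕜 := ℝ) (p := R t)).comp_hasDerivAt t h
  have h3 := ((h2.pow 2).const_mul A₁).sub ((h1.pow 2).const_mul A₂)
  simp only [hI']
  refine h3.congr_deriv ?_
  simp
  ring
end

section
/- Let A₁, A₂, A₃, λ ∈ ℝ and define f : ℝ² → ℝ² by f(r₁, r₂) = (A₁r₁(A₃r₂² + (λ²/2)A₂), A₂r₂(A₃r₁² + (λ²/2)A₁)), and I : ℝ² → ℝ by I(r₁, r₂) = A₁r₂² - A₂r₁². If R : ℝ → ℝ² is differentiable, satisfies R'(t) = f(R(t)) for all t, and I(R(0)) = 0, then I(R(t)) = 0 for all t. In particular the zero level set {(r₁, r₂) : A₁r₂² = A₂r₁²}, the union of the rays connecting the origin with the equilibria of f, is invariant under the flow of f. -/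
/-- The zero level set of the triad invariant `I(r₁, r₂) = A₁r₂² - A₂r₁²`
(the union of the rays connecting the origin with the equilibria) is invariant
under the flow of the reduced triad vector field `f`: if `I(R(0)) = 0` along a
solution `R' = f(R)`, then `I(R(t)) = 0` for all `t`. -/
theorem triad_zero_level_set_invariant (A₁ A₂ A₃ lam : ℝ)
    (f : ℝ × ℝ → ℝ × ℝ)
    (hf : ∀ r₁ r₂ : ℝ, f (r₁, r₂) =
      (A₁ * r₁ * (A₃ * r₂ ^ 2 + lam ^ 2 / 2 * A₂),
       A₂ * r₂ * (A₃ * r₁ ^ 2 + lam ^ 2 / 2 * A₁)))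
    (I : ℝ × ℝ → ℝ)
    (hI : ∀ r₁ r₂ : ℝ, I (r₁, r₂) = A₁ * r₂ ^ 2 - A₂ * r₁ ^ 2)
    (R : ℝ → ℝ × ℝ) (hR : ∀ t : ℝ, HasDerivAt R (f (R t)) t)
    (h0 : I (R 0) = 0) :
    ∀ t : ℝ, I (R t) = 0 := by
  have hI' : ∀ p : ℝ × ℝ, I p = A₁ * p.2 ^ 2 - A₂ * p.1 ^ 2 := fun p => hI p.1 p.2
  have h1 : ∀ t, HasDerivAt (fun s => (R s).1)
      (A₁ * (R t).1 * (A₃ * (R t).2 ^ 2 + lam ^ 2 / 2 * A₂)) t := by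
    intro t
    have h := (hasFDerivAt_fst (𝕜 := ℝ) (p := R t)).comp_hasDerivAt t (hR t)
    have e : f (R t) = _ := hf (R t).1 (R t).2
    rw [e] at h
    exact h
  have h2 : ∀ t, HasDerivAt (fun s => (R s).2)
      (A₂ * (R t).2 * (A₃ * (R t).1 ^ 2 + lam ^ 2 / 2 * A₁)) t := by
    intro t
    have h := (hasFDerivAt_snd (𝕜 := ℝ) (p := R t)).comp_hasDerivAt t (hR t)
    have e : f (R t) = _ := hf (R t).1 (R t).2
    rw [e] at h
    exact h
  have h3 : ∀ t, HasDerivAt (fun s => Real.exp (-(lam ^ 2 * A₁ * A₂) * s) *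
      (A₁ * (R s).2 ^ 2 - A₂ * (R s).1 ^ 2)) 0 t := by
    intro t
    have he := ((hasDerivAt_id t).const_mul (-(lam ^ 2 * A₁ * A₂))).exp
    have hJ := (((h2 t).pow 2).const_mul A₁).sub (((h1 t).pow 2).const_mul A₂)
    refine (he.mul hJ).congr_deriv ?_
    simp
    ring
  intro t
  have hc := is_const_of_deriv_eq_zero (fun t => (h3 t).differentiableAt)
    (fun t => (h3 t).deriv) t 0
  rw [hI'] at h0 ⊢
  simp only [h0, mul_zero] at hc
  exact (mul_eq_zero.mp hc).resolve_left (Real.exp_pos _).ne'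
end

section
/- Let Ω be a set and Ê : (Ω → ℝ) → ℝ a sublinear expectation. Then for all 1 < p, q < ∞ with 1/p + 1/q = 1 and all X, Y : Ω → ℝ, the Hölder inequality Ê(|XY|) ≤ (Ê(|X|^p))^(1/p) · (Ê(|Y|^q))^(1/q) holds. -/
/-- A sublinear expectation on the real-valued functions on a set `Ω`:
monotone, constant-preserving, subadditive and positively homogeneous. -/
structure SublinearExpectation (Ω : Type*) where
  E : (Ω → ℝ) → ℝ
  monotone : ∀ X Y : Ω → ℝ, (∀ ω, X ω ≤ Y ω) → E X ≤ E Y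
  const : ∀ c : ℝ, E (fun _ => c) = c
  subadd : ∀ X Y : Ω → ℝ, E (fun ω => X ω + Y ω) ≤ E X + E Y
  pos_hom : ∀ l : ℝ, 0 ≤ l → ∀ X : Ω → ℝ, E (fun ω => l * X ω) = l * E X


/-- Hölder inequality for sublinear expectations:
`Ê(|XY|) ≤ (Ê(|X|^p))^(1/p) (Ê(|Y|^q))^(1/q)` for conjugate exponents
`1 < p, q < ∞` with `1/p + 1/q = 1`. -/
theorem sublinear_expectation_holder {Ω : Type*}
    (Ehat : SublinearExpectation Ω) (p q : ℝ) (hp : 1 < p) (hq : 1 < q)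
    (hpq : 1 / p + 1 / q = 1) (X Y : Ω → ℝ) :
    Ehat.E (fun ω => |X ω * Y ω|) ≤
      (Ehat.E (fun ω => |X ω| ^ p)) ^ (1 / p) *
        (Ehat.E (fun ω => |Y ω| ^ q)) ^ (1 / q) := by
  have hp0 : 0 < p := by linarith
  have hq0 : 0 < q := by linarith
  have hc : p.HolderConjugate q :=
    Real.holderConjugate_iff.mpr ⟨hp, by simpa [one_div] using hpq⟩
  have nonneg : ∀ Z : Ω → ℝ, (∀ ω, 0 ≤ Z ω) → 0 ≤ Ehat.E Z := fun Z hZ => by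
    have h := Ehat.monotone (fun _ => 0) Z hZ
    rwa [Ehat.const] at h
  have hA : 0 ≤ Ehat.E (fun ω => |X ω| ^ p) := nonneg _ fun ω => by positivity
  have hB : 0 ≤ Ehat.E (fun ω => |Y ω| ^ q) := nonneg _ fun ω => by positivity
  set A := Ehat.E (fun ω => |X ω| ^ p) with hAdef
  set B := Ehat.E (fun ω => |Y ω| ^ q) with hBdef
  have key : ∀ a b : ℝ, 0 < a → 0 < b → A ≤ a → B ≤ b →
      Ehat.E (fun ω => |X ω * Y ω|) ≤ a ^ (1 / p) * b ^ (1 / q) := by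
    intro a b ha hb hAa hBb
    have hap : 0 < a ^ (1 / p) := Real.rpow_pos_of_pos ha _
    have hbq : 0 < b ^ (1 / q) := Real.rpow_pos_of_pos hb _
    have hap' : (a ^ (1 / p)) ^ p = a := by
      rw [← Real.rpow_mul ha.le, one_div_mul_cancel hp0.ne', Real.rpow_one]
    have hbq' : (b ^ (1 / q)) ^ q = b := by
      rw [← Real.rpow_mul hb.le, one_div_mul_cancel hq0.ne', Real.rpow_one]
    set u := a ^ (1 / p)
    set v := b ^ (1 / q)
    have h1 : ∀ ω, |X ω * Y ω| ≤
        (u * v / (a * p)) * |X ω| ^ p + (u * v / (b * q)) * |Y ω| ^ q := by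
      intro ω
      have hy := Real.young_inequality_of_nonneg (a := |X ω| / u) (b := |Y ω| / v)
        (by positivity) (by positivity) hc
      rw [Real.div_rpow (abs_nonneg _) hap.le, Real.div_rpow (abs_nonneg _) hbq.le,
        hap', hbq'] at hy
      have h2 := mul_le_mul_of_nonneg_left hy (mul_pos hap hbq).le
      rw [abs_mul]
      calc |X ω| * |Y ω| = u * v * (|X ω| / u * (|Y ω| / v)) := by field_simp
        _ ≤ _ := h2
        _ = _ := by field_simp
    have h3 := Ehat.monotone _ _ h1
    have h4 := Ehat.subadd (fun ω => (u * v / (a * p)) * |X ω| ^ p)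
      (fun ω => (u * v / (b * q)) * |Y ω| ^ q)
    rw [Ehat.pos_hom _ (by positivity), Ehat.pos_hom _ (by positivity), ← hAdef, ← hBdef] at h4
    have h5 : u * v / (a * p) * A ≤ u * v / (a * p) * a :=
      mul_le_mul_of_nonneg_left hAa (by positivity)
    have h6 : u * v / (b * q) * B ≤ u * v / (b * q) * b :=
      mul_le_mul_of_nonneg_left hBb (by positivity)
    have h7 : u * v / (a * p) * a + u * v / (b * q) * b = u * v := by
      calc _ = u * v * (1 / p + 1 / q) := by field_simp
        _ = _ := by rw [hpq, mul_one]
    linarith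
  have hcont : Continuous fun ε : ℝ => (A + ε) ^ (1 / p) * (B + ε) ^ (1 / q) :=
    ((continuous_const.add continuous_id).rpow_const fun _ => Or.inr (by positivity)).mul
      ((continuous_const.add continuous_id).rpow_const fun _ => Or.inr (by positivity))
  have ht : Filter.Tendsto (fun ε : ℝ => (A + ε) ^ (1 / p) * (B + ε) ^ (1 / q))
      (nhdsWithin 0 (Set.Ioi 0)) (nhds (A ^ (1 / p) * B ^ (1 / q))) := by
    have h := hcont.tendsto 0
    simp only [add_zero] at h
    exact h.mono_left nhdsWithin_le_nhds
  refine ge_of_tendsto ht ?_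
  filter_upwards [self_mem_nhdsWithin] with ε hε
  have hε' : 0 < ε := hε
  exact key _ _ (by linarith) (by linarith) (by linarith) (by linarith)
end

section
/- Let Ω be a set and Ê : (Ω → ℝ) → ℝ a sublinear expectation. Then for every 1 < p < ∞ and all X, Y : Ω → ℝ, the Minkowski inequality (Ê(|X + Y|^p))^(1/p) ≤ (Ê(|X|^p))^(1/p) + (Ê(|Y|^p))^(1/p) holds. -/
/-- Minkowski inequality for sublinear expectations:
`(Ê(|X + Y|^p))^(1/p) ≤ (Ê(|X|^p))^(1/p) + (Ê(|Y|^p))^(1/p)` for `1 < p < ∞`. -/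
theorem sublinear_expectation_minkowski {Ω : Type*}
    (Ehat : SublinearExpectation Ω) (p : ℝ) (hp : 1 < p) (X Y : Ω → ℝ) :
    (Ehat.E (fun ω => |X ω + Y ω| ^ p)) ^ (1 / p) ≤
      (Ehat.E (fun ω => |X ω| ^ p)) ^ (1 / p) +
        (Ehat.E (fun ω => |Y ω| ^ p)) ^ (1 / p) := by
  have hp0 : 0 < p := by linarith
  have hA : 0 ≤ Ehat.E (fun ω => |X ω| ^ p) := by
    rw [← Ehat.const 0]
    exact Ehat.monotone _ _ (fun ω => by positivity)
  have hB : 0 ≤ Ehat.E (fun ω => |Y ω| ^ p) := by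
    rw [← Ehat.const 0]
    exact Ehat.monotone _ _ (fun ω => by positivity)
  have hC : 0 ≤ Ehat.E (fun ω => |X ω + Y ω| ^ p) := by
    rw [← Ehat.const 0]
    exact Ehat.monotone _ _ (fun ω => by positivity)
  -- a strict upper bound `s ^ p` for each moment
  have key : ∀ s t : ℝ, 0 < s → 0 < t → Ehat.E (fun ω => |X ω| ^ p) ≤ s ^ p →
      Ehat.E (fun ω => |Y ω| ^ p) ≤ t ^ p →
      Ehat.E (fun ω => |X ω + Y ω| ^ p) ≤ (s + t) ^ p := by
    intro s t hs ht h1 h2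
    have hst : 0 < s + t := by linarith
    have hsp : 0 < s ^ p := Real.rpow_pos_of_pos hs p
    have htp : 0 < t ^ p := Real.rpow_pos_of_pos ht p
    have hstp : 0 < (s + t) ^ p := Real.rpow_pos_of_pos hst p
    have hsum : s / (s + t) + t / (s + t) = 1 := by field_simp
    have hc1 : 0 ≤ (s + t) ^ p * (s / (s + t)) / s ^ p := by positivity
    have hc2 : 0 ≤ (s + t) ^ p * (t / (s + t)) / t ^ p := by positivity
    have hpt : ∀ ω, |X ω + Y ω| ^ p ≤ (s + t) ^ p * (s / (s + t)) / s ^ p * |X ω| ^ p +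
        (s + t) ^ p * (t / (s + t)) / t ^ p * |Y ω| ^ p := by
      intro ω
      have hx : 0 ≤ |X ω| / s := by positivity
      have hy : 0 ≤ |Y ω| / t := by positivity
      have hconv := (convexOn_rpow hp.le).2 (Set.mem_Ici.2 hx) (Set.mem_Ici.2 hy)
        (show 0 ≤ s / (s + t) by positivity) (show 0 ≤ t / (s + t) by positivity) hsum
      simp only [smul_eq_mul] at hconv
      have e1 : s / (s + t) * (|X ω| / s) + t / (s + t) * (|Y ω| / t)
          = (|X ω| + |Y ω|) / (s + t) := by field_simp
      rw [e1, Real.div_rpow (by positivity) hst.le, Real.div_rpow (by positivity) hs.le,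
        Real.div_rpow (by positivity) ht.le, div_le_iff₀ hstp] at hconv
      calc |X ω + Y ω| ^ p ≤ (|X ω| + |Y ω|) ^ p :=
            Real.rpow_le_rpow (abs_nonneg _) (abs_add_le _ _) hp0.le
        _ ≤ _ := hconv
        _ = _ := by ring
    calc Ehat.E (fun ω => |X ω + Y ω| ^ p) ≤ _ := Ehat.monotone _ _ hpt
      _ ≤ _ := Ehat.subadd _ _
      _ = (s + t) ^ p * (s / (s + t)) / s ^ p * Ehat.E (fun ω => |X ω| ^ p) +
          (s + t) ^ p * (t / (s + t)) / t ^ p * Ehat.E (fun ω => |Y ω| ^ p) := by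
        rw [Ehat.pos_hom _ hc1, Ehat.pos_hom _ hc2]
      _ ≤ (s + t) ^ p * (s / (s + t)) / s ^ p * s ^ p +
          (s + t) ^ p * (t / (s + t)) / t ^ p * t ^ p :=
        add_le_add (mul_le_mul_of_nonneg_left h1 hc1) (mul_le_mul_of_nonneg_left h2 hc2)
      _ = (s + t) ^ p * (s / (s + t) + t / (s + t)) := by
        rw [div_mul_cancel₀ _ hsp.ne', div_mul_cancel₀ _ htp.ne']; ring
      _ = (s + t) ^ p := by rw [hsum, mul_one]
  have bound : ∀ A ε : ℝ, 0 ≤ A → 0 < ε → A ≤ (A ^ (1 / p) + ε) ^ p := by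
    intro A ε hA hε
    calc A = (A ^ (1 / p)) ^ p := by
          rw [← Real.rpow_mul hA, one_div_mul_cancel hp0.ne', Real.rpow_one]
      _ ≤ _ := Real.rpow_le_rpow (Real.rpow_nonneg hA _) (by linarith) hp0.le
  apply le_of_forall_pos_le_add
  intro ε hε
  have hε2 : 0 < ε / 2 := by linarith
  have ha := Real.rpow_nonneg hA (1 / p)
  have hb := Real.rpow_nonneg hB (1 / p)
  have h := key _ _ (add_pos_of_nonneg_of_pos ha hε2) (add_pos_of_nonneg_of_pos hb hε2)
    (bound _ _ hA hε2) (bound _ _ hB hε2)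
  have h' := Real.rpow_le_rpow hC h (show 0 ≤ 1 / p by positivity)
  rw [← Real.rpow_mul (by linarith), mul_one_div_cancel hp0.ne', Real.rpow_one] at h'
  linarith
end
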